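/- arXiv:1901.06169 — 11 statements merged into one kernel-verified Lean document; each statement's English description precedes it below -/
import Mathlib

section
/- Let μ ∈ ℝ. The operator P_B(μ) : D(L) → H, defined by P_B(μ)u = −Lu − iμBu + μ²u, is bijective from D(L) onto H if and only if every nonzero u ∈ D(L) satisfying Lu = μ²u has ⟪Bu, u⟫ ≠ 0. (Equivalence (ii) ⇔ (iii) of Proposition 'prop-resolvent' in the paper.) -/
local notation "⟪" x ", " y "⟫" => @inner ℂ _ _ x y

open ContinuousLinearMap in
/-- A positive bounded operator annihilates every vector on which its quadratic form vanishes. -/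
theorem ContinuousLinearMap.IsPositive.apply_eq_zero_of_inner_eq_zero
    {H : Type*} [NormedAddCommGroup H] [InnerProductSpace ℂ H] [CompleteSpace H]
    {B : H →L[ℂ] H} (hB : B.IsPositive) {u : H} (hu : ⟪B u, u⟫ = 0) : B u = 0 := by
  obtain ⟨b, rfl⟩ := CStarAlgebra.nonneg_iff_eq_star_mul_self.mp
    (B.nonneg_iff_isPositive.mpr hB)
  rw [mul_apply_eq_comp, star_eq_adjoint, adjoint_inner_left, inner_self_eq_zero] at hu
  rw [mul_apply_eq_comp, hu, map_zero]

/-- Proposition `prop-resolvent`, (ii) ⇔ (iii).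
`H` is a complex Hilbert space, `L` a densely defined self-adjoint (symmetric) operator
with domain `D`, positive definite, with compact resolvent (`L` is bijective from `D`
onto `H` with compact inverse `T`), and `B` is a bounded self-adjoint nonnegative
operator.  Then `P_B(μ) : u ↦ -Lu - iμBu + μ²u` is bijective from `D` onto `H`
if and only if every nonzero `u ∈ D` with `Lu = μ²u` satisfies `⟪Bu, u⟫ ≠ 0`. -/
theorem stmt_0
    {H : Type*} [NormedAddCommGroup H] [InnerProductSpace ℂ H] [CompleteSpace H]
    (D : Submodule ℂ H) (hdense : Dense (D : Set H))
    (L : D →ₗ[ℂ] H)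
    (hsym : ∀ u v : D, ⟪L u, (v : H)⟫ = ⟪(u : H), L v⟫)
    (hposdef : ∃ c : ℝ, 0 < c ∧ ∀ u : D, c * ‖(u : H)‖ ^ 2 ≤ (⟪L u, (u : H)⟫).re)
    (T : H →L[ℂ] H) (hTcompact : IsCompactOperator (⇑T))
    (hTL : ∀ u : D, T (L u) = (u : H))
    (hLT : ∀ v : H, ∃ hv : T v ∈ D, L ⟨T v, hv⟩ = v)
    (B : H →L[ℂ] H) (hBsa : IsSelfAdjoint B)
    (hBpos : ∀ w : H, 0 ≤ (⟪B w, w⟫).re)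
    (μ : ℝ) :
    Function.Bijective
        (fun u : D => -(L u) - (Complex.I * (μ : ℂ)) • B (u : H) + ((μ : ℂ) ^ 2) • (u : H))
      ↔ ∀ u : D, u ≠ 0 → L u = ((μ : ℂ) ^ 2) • (u : H) → ⟪B (u : H), (u : H)⟫ ≠ 0 := by
  have hB : B.IsPositive :=
    ContinuousLinearMap.isPositive_def'.mpr ⟨hBsa, hBpos⟩
  constructor
  · intro hbij u hu hLu hBu
    refine hu (hbij.injective ?_)
    simp [hB.apply_eq_zero_of_inner_eq_zero hBu, hLu]
  intro h
  have hL_inj : ∀ u : D, L u = 0 → u = 0 := fun u hu => by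
    have := hTL u
    rw [hu, map_zero] at this
    exact Subtype.ext this.symm
  have hker : ∀ u : D,
      -(L u) - (Complex.I * (μ : ℂ)) • B (u : H) + ((μ : ℂ) ^ 2) • (u : H) = 0 → u = 0 := by
    intro u hu
    by_contra hu0
    have hLim : (⟪(u : H), L u⟫).im = 0 :=
      Complex.conj_eq_iff_im.mp (by rw [inner_conj_symm, hsym])
    have hBim : (⟪(u : H), B u⟫).im = 0 :=
      Complex.conj_eq_iff_im.mp (by rw [inner_conj_symm, hB.inner_left_eq_inner_right])
    have hUim : (⟪(u : H), (u : H)⟫).im = 0 :=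
      Complex.conj_eq_iff_im.mp (inner_conj_symm _ _)
    have him : μ * (⟪(u : H), B u⟫).re = 0 := by
      have := congrArg (fun x => (⟪(u : H), x⟫).im) hu
      simp only [inner_add_right, inner_sub_right, inner_neg_right, inner_smul_right,
        inner_zero_right] at this
      simpa [hLim, hBim, hUim, ← Complex.ofReal_pow, -inner_self_eq_norm_sq_to_K] using this
    have hμB : (μ : ℂ) • B (u : H) = 0 := by
      rcases mul_eq_zero.mp him with h0 | h0
      · simp [h0]
      · have : ⟪B (u : H), (u : H)⟫ = 0 := by
          rw [hB.inner_left_eq_inner_right]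
          exact Complex.ext h0 hBim
        rw [hB.apply_eq_zero_of_inner_eq_zero this, smul_zero]
    rw [mul_smul, hμB, smul_zero, sub_zero, neg_add_eq_zero] at hu
    have hne := h u hu0 hu
    have hμ : μ = 0 := by
      by_contra hμ
      have hBu := (smul_eq_zero.mp hμB).resolve_left (by exact_mod_cast hμ)
      exact hne (by rw [hBu, inner_zero_left])
    exact hu0 (hL_inj u (by rw [hu, hμ]; simp))
  refine ⟨fun u v huv => sub_eq_zero.mp (hker _ ?_), fun f => ?_⟩
  · have := sub_eq_zero.mpr huv
    simp only [map_sub, Submodule.coe_sub, smul_sub]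
    rw [← this]
    module
  let S : H →L[ℂ] H := ((μ : ℂ) ^ 2) • 1 - (Complex.I * (μ : ℂ)) • B
  have hP : ∀ v : H, -(L ⟨T v, (hLT v).1⟩) - (Complex.I * (μ : ℂ)) • B (T v)
      + ((μ : ℂ) ^ 2) • T v = (S ∘L T) v - v := by
    intro v
    rw [(hLT v).2]
    simp only [S, ContinuousLinearMap.comp_apply, sub_apply,
      smul_apply, one_apply_eq_self]
    abel
  have hK : IsCompactOperator (S ∘L T) := hTcompact.clm_comp S
  have hres := (hK.hasEigenvalue_or_mem_resolventSet one_ne_zero).resolve_left fun hev => by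
    obtain ⟨v, hv⟩ := hev.exists_hasEigenvector
    have hSv : (S ∘L T) v = v := by simpa using hv.apply_eq_smul
    have h0 := hker ⟨T v, (hLT v).1⟩ ((hP v).trans (by rw [hSv, sub_self]))
    apply hv.2
    rw [← (hLT v).2, h0, map_zero]
  obtain ⟨R, hR⟩ := (spectrum.mem_resolventSet_iff.mp hres).exists_right_inv
  have hRf := congrArg (fun A : H →L[ℂ] H => A (-f)) hR
  simp only [map_one, mul_apply_eq_comp, sub_apply,
    one_apply_eq_self] at hRf
  refine ⟨⟨T (R (-f)), (hLT _).1⟩, (hP _).trans ?_⟩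
  rw [← neg_sub, hRf, neg_neg]
end

section
/- Let μ ∈ ℝ with μ ≠ 0. If u ∈ D(L) satisfies −Lu − iμBu + μ²u = 0, then Bu = 0 and Lu = μ²u. (Kernel identification step in the proof of Proposition 'prop-resolvent'.) -/
local notation "⟪" x ", " y "⟫" => @inner ℂ _ _ x y

/-- A positive operator annihilates every vector at which its quadratic form vanishes. -/
theorem ContinuousLinearMap.IsPositive.apply_eq_zero_of_re_inner_eq_zero
    {H : Type*} [NormedAddCommGroup H] [InnerProductSpace ℂ H] [CompleteSpace H]
    {B : H →L[ℂ] H} (hB : B.IsPositive) {u : H} (hu : (inner ℂ (B u) u).re = 0) :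
    B u = 0 := by
  obtain ⟨S, rfl⟩ := CStarAlgebra.nonneg_iff_eq_star_mul_self.mp
    ((ContinuousLinearMap.nonneg_iff_isPositive B).mpr hB)
  have hS : ‖S u‖ ^ 2 = 0 := by
    rwa [mul_apply_eq_comp, ContinuousLinearMap.star_eq_adjoint,
      ContinuousLinearMap.adjoint_inner_left, ← RCLike.re_eq_complex_re,
      inner_self_eq_norm_sq] at hu
  rw [mul_apply_eq_comp, norm_eq_zero.mp (pow_eq_zero_iff two_ne_zero |>.mp hS),
    map_zero]

/-- kernel identification in the proof of Proposition `prop-resolvent`.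
If `μ ≠ 0` and `u ∈ D(L)` satisfies `-Lu - iμBu + μ²u = 0`, where `L` is symmetric on its
domain and `B` is bounded, self-adjoint and nonnegative, then `Bu = 0` and `Lu = μ²u`. -/
theorem stmt_1
    {H : Type*} [NormedAddCommGroup H] [InnerProductSpace ℂ H] [CompleteSpace H]
    (D : Submodule ℂ H) (L : D →ₗ[ℂ] H)
    (hsym : ∀ u v : D, ⟪L u, (v : H)⟫ = ⟪(u : H), L v⟫)
    (B : H →L[ℂ] H) (hBsa : IsSelfAdjoint B)
    (hBpos : ∀ w : H, 0 ≤ (⟪B w, w⟫).re)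
    (μ : ℝ) (hμ : μ ≠ 0) (u : D)
    (hu : -(L u) - (Complex.I * (μ : ℂ)) • B (u : H) + ((μ : ℂ) ^ 2) • (u : H) = 0) :
    B (u : H) = 0 ∧ L u = ((μ : ℂ) ^ 2) • (u : H) := by
  have hL : L u = ((μ : ℂ) ^ 2) • (u : H) - (Complex.I * (μ : ℂ)) • B (u : H) := by
    linear_combination (norm := module) (-1 : ℂ) • hu
  have him : (⟪L u, (u : H)⟫).im = 0 :=
    Complex.conj_eq_iff_im.mp ((inner_conj_symm _ _).trans (hsym u u).symm)
  have hre : (⟪B (u : H), (u : H)⟫).re = 0 := by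
    have hu_im : (⟪(u : H), (u : H)⟫).im = 0 := inner_self_im (𝕜 := ℂ) (u : H)
    rw [hL, inner_sub_left, inner_smul_left, inner_smul_left] at him
    simpa [pow_two, hu_im, hμ] using him
  have hBu : B (u : H) = 0 :=
    ContinuousLinearMap.IsPositive.apply_eq_zero_of_re_inner_eq_zero
      (ContinuousLinearMap.isPositive_def'.mpr ⟨hBsa, hBpos⟩) hre
  exact ⟨hBu, by rw [hL, hBu, smul_zero, sub_zero]⟩
end

section
/- Let μ ∈ ℝ with μ ≠ 0 and let f > 0, g > 0 be real numbers. Assume the observability estimate: for every u ∈ D(L), ‖u‖ ≤ (f/|μ|)·‖P(μ)u‖ + g·‖√B u‖. Then for every u ∈ D(L), ‖u‖ ≤ (M/|μ|)·‖P_B(μ)u‖, where M = 9·max(f, f²·‖√B‖², g²) and ‖√B‖ is the operator norm of √B. (Proposition 'prop-1-appendix' of the paper; the constant 9·max is the one produced by the paper's proof.) -/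
local notation "⟪" x ", " y "⟫" => @inner ℂ _ _ x y

/-- If `x` is bounded by `w` and `s`, and `s ^ 2` is controlled by `w * x`, then `s` can be
absorbed, leaving a bound of `x` by `w` alone. -/
theorem absorption_estimate {x w s f g σ m : ℝ} (hm : 0 < m) (hx : 0 ≤ x) (hw : 0 ≤ w)
    (hs : 0 ≤ s) (hobs : x ≤ f / m * w + (f * σ + g) * s) (hdiss : m * s ^ 2 ≤ w * x) :
    x ≤ 9 * max f (max (f ^ 2 * σ ^ 2) (g ^ 2)) / m * w := by
  set K := max f (max (f ^ 2 * σ ^ 2) (g ^ 2)) with hK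
  have hfK : f ≤ K := le_max_left _ _
  have hσK : (f * σ) ^ 2 ≤ K := by
    rw [mul_pow]
    exact (le_max_left _ _).trans (le_max_right _ _)
  have hgK : g ^ 2 ≤ K := (le_max_right _ _).trans (le_max_right _ _)
  have hK0 : 0 ≤ K := (sq_nonneg g).trans hgK
  set t := K * (w / m) with ht
  have ht0 : 0 ≤ t := by positivity
  have hfw : f / m * w ≤ t := by
    rw [div_mul_eq_mul_div, mul_div_assoc]
    exact mul_le_mul_of_nonneg_right hfK (by positivity)
  have hcoef : f * σ + g ≤ 2 * √K := by
    linarith [Real.le_sqrt_of_sq_le hσK, Real.le_sqrt_of_sq_le hgK]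
  have hs2 : s ^ 2 ≤ w / m * x := by
    rw [div_mul_eq_mul_div, le_div_iff₀ hm]
    linarith
  have hr2 : (√K * s) ^ 2 ≤ t * x := by
    rw [mul_pow, Real.sq_sqrt hK0, ht, mul_assoc]
    exact mul_le_mul_of_nonneg_left hs2 hK0
  have hr : √K * s ≤ t + x / 4 :=
    abs_le_of_sq_le_sq' (hr2.trans (by nlinarith [sq_nonneg (t - x / 4)])) (by positivity) |>.2
  have hmul : (f * σ + g) * s ≤ 2 * √K * s := mul_le_mul_of_nonneg_right hcoef hs
  have hgoal : 9 * K / m * w = 9 * t := by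
    rw [ht]
    ring
  rw [hgoal]
  linarith

/-- Proposition `prop-1-appendix`.
`L` symmetric on its domain `D`, `B` bounded self-adjoint nonnegative with nonnegative
self-adjoint square root `S = √B`.  If `μ ≠ 0`, `f, g > 0` and the observability estimate
`‖u‖ ≤ (f/|μ|)‖P(μ)u‖ + g‖√B u‖` holds for all `u ∈ D` (where `P(μ)u = -Lu + μ²u`),
then `‖u‖ ≤ (M/|μ|)‖P_B(μ)u‖` for all `u ∈ D`, where
`P_B(μ)u = -Lu - iμBu + μ²u` and `M = 9·max(f, f²‖√B‖², g²)`. -/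
theorem stmt_3
    {H : Type*} [NormedAddCommGroup H] [InnerProductSpace ℂ H] [CompleteSpace H]
    (D : Submodule ℂ H) (L : D →ₗ[ℂ] H)
    (hsym : ∀ u v : D, ⟪L u, (v : H)⟫ = ⟪(u : H), L v⟫)
    (B S : H →L[ℂ] H) (hBsa : IsSelfAdjoint B)
    (hBpos : ∀ w : H, 0 ≤ (⟪B w, w⟫).re)
    (hSsa : IsSelfAdjoint S) (hSpos : ∀ w : H, 0 ≤ (⟪S w, w⟫).re)
    (hSB : ∀ w : H, S (S w) = B w)
    (μ : ℝ) (hμ : μ ≠ 0) (f g : ℝ) (hf : 0 < f) (hg : 0 < g)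
    (hobs : ∀ u : D,
      ‖(u : H)‖ ≤ f / |μ| * ‖-(L u) + ((μ : ℂ) ^ 2) • (u : H)‖ + g * ‖S (u : H)‖) :
    ∀ u : D,
      ‖(u : H)‖ ≤ 9 * max f (max (f ^ 2 * ‖S‖ ^ 2) (g ^ 2)) / |μ| *
        ‖-(L u) - (Complex.I * (μ : ℂ)) • B (u : H) + ((μ : ℂ) ^ 2) • (u : H)‖ := by
  intro u
  set x : H := (u : H) with hx
  set w : H := -(L u) - (Complex.I * (μ : ℂ)) • B x + ((μ : ℂ) ^ 2) • x with hw
  have hm : 0 < |μ| := abs_pos.mpr hμ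
  have hadj : ⟪x, B x⟫ = ((‖S x‖ ^ 2 : ℝ) : ℂ) := by
    rw [← hSB x, ← ContinuousLinearMap.adjoint_inner_left, hSsa.adjoint_eq,
      inner_self_eq_norm_sq_to_K]
    norm_cast
  have hLim : (⟪x, L u⟫).im = 0 := by
    have h := congrArg Complex.im (hsym u u)
    rw [← inner_conj_symm, Complex.conj_im] at h
    linarith
  have him : (⟪x, w⟫).im = -(μ * ‖S x‖ ^ 2) := by
    have hxx : ⟪x, x⟫ = ((‖x‖ ^ 2 : ℝ) : ℂ) := by
      rw [inner_self_eq_norm_sq_to_K]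
      norm_cast
    rw [hw, inner_add_right, inner_sub_right, inner_neg_right, inner_smul_right,
      inner_smul_right, hadj, hxx, mul_assoc, ← Complex.ofReal_mul, ← Complex.ofReal_pow,
      ← Complex.ofReal_mul]
    simp [hLim, -Complex.ofReal_pow]
  have hdiss : |μ| * ‖S x‖ ^ 2 ≤ ‖w‖ * ‖x‖ := by
    calc |μ| * ‖S x‖ ^ 2 = |(⟪x, w⟫).im| := by
          rw [him, abs_neg, abs_mul, abs_of_nonneg (sq_nonneg ‖S x‖)]
      _ ≤ ‖⟪x, w⟫‖ := Complex.abs_im_le_norm _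
      _ ≤ ‖x‖ * ‖w‖ := norm_inner_le_norm _ _
      _ = ‖w‖ * ‖x‖ := mul_comm _ _
  have hP : ‖-(L u) + ((μ : ℂ) ^ 2) • x‖ ≤ ‖w‖ + |μ| * (‖S‖ * ‖S x‖) := by
    have hdecomp : -(L u) + ((μ : ℂ) ^ 2) • x = w + (Complex.I * (μ : ℂ)) • B x := by
      rw [hw]
      abel
    rw [hdecomp]
    refine (norm_add_le _ _).trans (add_le_add_right ?_ _)
    rw [norm_smul, norm_mul, Complex.norm_I, one_mul, Complex.norm_real, Real.norm_eq_abs,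
      ← hSB x]
    exact mul_le_mul_of_nonneg_left (S.le_opNorm _) hm.le
  refine absorption_estimate hm (norm_nonneg _) (norm_nonneg _) (norm_nonneg (S x)) ?_ hdiss
  calc ‖x‖ ≤ f / |μ| * ‖-(L u) + ((μ : ℂ) ^ 2) • x‖ + g * ‖S x‖ := hobs u
    _ ≤ f / |μ| * (‖w‖ + |μ| * (‖S‖ * ‖S x‖)) + g * ‖S x‖ := by gcongr
    _ = f / |μ| * ‖w‖ + (f * ‖S‖ + g) * ‖S x‖ := by
      field_simp
      ring
end

section
/- Let Q : H → H be an orthogonal projection, let μ ∈ ℝ with μ ≠ 0, and let f > 0, g > 0 be real numbers. Assume the observability estimate: for every u ∈ D(L), ‖u‖ ≤ (f/|μ|)·‖P(μ)u‖ + g·‖√B u‖. Then for every u ∈ D(L) with Qu = u, one has ‖u‖ ≤ (M/|μ|)·‖P_{QBQ}(μ)u‖, where P_{QBQ}(μ)u = −Lu − iμ·QBQu + μ²u, M = 9·max(f, f²·‖√B‖², g²), and ‖√B‖ is the operator norm of √B. (Proposition 'prop-1-appendix-high-frequencies' of the paper, stated for an arbitrary orthogonal projection Q in place of the spectral projections Q_n;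 the constant 9·max is the one produced by the paper's proof.) -/
local notation "⟪" x ", " y "⟫" => @inner ℂ _ _ x y

/-- A bounded self-adjoint idempotent operator does not increase norms. -/
theorem norm_apply_le_of_isSelfAdjoint_of_idempotent
    {H : Type*} [NormedAddCommGroup H] [InnerProductSpace ℂ H] [CompleteSpace H]
    {Q : H →L[ℂ] H} (hQsa : IsSelfAdjoint Q) (hQproj : ∀ w : H, Q (Q w) = Q w) (w : H) :
    ‖Q w‖ ≤ ‖w‖ := by
  have h : ⟪Q w, Q w⟫ = ⟪w, Q w⟫ := by
    have h := hQsa.isSymmetric w (Q w)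
    simpa [hQproj] using h
  have h2 : ‖Q w‖ * ‖Q w‖ ≤ ‖w‖ * ‖Q w‖ := by
    have h3 := norm_inner_le_norm (𝕜 := ℂ) w (Q w)
    rw [← h, inner_self_eq_norm_sq_to_K] at h3
    simpa [sq] using h3
  by_contra! hlt
  have hpos : 0 < ‖Q w‖ := (norm_nonneg w).trans_lt hlt
  exact absurd (le_of_mul_le_mul_right h2 hpos) (not_le.mpr hlt)

/-- Absorption: `N ≤ f φ + (f s + g) y` and `y² ≤ φ N` bound `N` by a multiple of `φ`. -/
theorem le_nine_mul_max_of_le_add {N φ y f g s : ℝ} (hN : 0 ≤ N) (hφ : 0 ≤ φ)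
    (hobs : N ≤ f * φ + (f * s + g) * y) (hy : y ^ 2 ≤ φ * N) :
    N ≤ 9 * max f (max (f ^ 2 * s ^ 2) (g ^ 2)) * φ := by
  set M := max f (max (f ^ 2 * s ^ 2) (g ^ 2))
  have h1 : f ≤ M := le_max_left _ _
  have h2 : f ^ 2 * s ^ 2 ≤ M := (le_max_left _ _).trans (le_max_right _ _)
  have h3 : g ^ 2 ≤ M := (le_max_right _ _).trans (le_max_right _ _)
  have hM : 0 ≤ M := (sq_nonneg g).trans h3
  have hsum : (f * s + g) ^ 2 ≤ 4 * M := by nlinarith [sq_nonneg (f * s - g)]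
  have hprod : ((f * s + g) * y) ^ 2 ≤ (2 * M * φ + N / 2) ^ 2 := by
    calc ((f * s + g) * y) ^ 2 = (f * s + g) ^ 2 * y ^ 2 := by ring
      _ ≤ 4 * M * (φ * N) := by gcongr
      _ ≤ (2 * M * φ + N / 2) ^ 2 := by nlinarith [sq_nonneg (2 * M * φ - N / 2)]
  have habs : (f * s + g) * y ≤ 2 * M * φ + N / 2 :=
    (le_abs_self _).trans (abs_le_of_sq_le_sq hprod (by positivity))
  have hfφ : f * φ ≤ M * φ := by gcongr
  have hMφ : 0 ≤ M * φ := by positivity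
  linarith

/-- Proposition `prop-1-appendix-high-frequencies`, for an arbitrary
orthogonal projection `Q`.  `L` symmetric on its domain `D`, `B` bounded self-adjoint
nonnegative with nonnegative self-adjoint square root `S = √B`, `Q` an orthogonal
projection (bounded, self-adjoint, idempotent).  If `μ ≠ 0`, `f, g > 0` and
`‖u‖ ≤ (f/|μ|)‖P(μ)u‖ + g‖√B u‖` for all `u ∈ D`, then for every `u ∈ D` with `Qu = u`,
`‖u‖ ≤ (M/|μ|)‖P_{QBQ}(μ)u‖`, where `P_{QBQ}(μ)u = -Lu - iμ·QBQu + μ²u` and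
`M = 9·max(f, f²‖√B‖², g²)`. -/
theorem stmt_4
    {H : Type*} [NormedAddCommGroup H] [InnerProductSpace ℂ H] [CompleteSpace H]
    (D : Submodule ℂ H) (L : D →ₗ[ℂ] H)
    (hsym : ∀ u v : D, ⟪L u, (v : H)⟫ = ⟪(u : H), L v⟫)
    (B S : H →L[ℂ] H) (hBsa : IsSelfAdjoint B)
    (hBpos : ∀ w : H, 0 ≤ (⟪B w, w⟫).re)
    (hSsa : IsSelfAdjoint S) (hSpos : ∀ w : H, 0 ≤ (⟪S w, w⟫).re)
    (hSB : ∀ w : H, S (S w) = B w)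
    (Q : H →L[ℂ] H) (hQsa : IsSelfAdjoint Q) (hQproj : ∀ w : H, Q (Q w) = Q w)
    (μ : ℝ) (hμ : μ ≠ 0) (f g : ℝ) (hf : 0 < f) (hg : 0 < g)
    (hobs : ∀ u : D,
      ‖(u : H)‖ ≤ f / |μ| * ‖-(L u) + ((μ : ℂ) ^ 2) • (u : H)‖ + g * ‖S (u : H)‖) :
    ∀ u : D, Q (u : H) = (u : H) →
      ‖(u : H)‖ ≤ 9 * max f (max (f ^ 2 * ‖S‖ ^ 2) (g ^ 2)) / |μ| *
        ‖-(L u) - (Complex.I * (μ : ℂ)) • Q (B (Q (u : H))) + ((μ : ℂ) ^ 2) • (u : H)‖ := by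
  intro u hu
  have hm : 0 < |μ| := abs_pos.mpr hμ
  set F : H := -(L u) - (Complex.I * (μ : ℂ)) • Q (B (Q (u : H))) + ((μ : ℂ) ^ 2) • (u : H)
    with hF
  have hQB : ⟪Q (B (Q (u : H))), (u : H)⟫ = ((‖S (u : H)‖ ^ 2 : ℝ) : ℂ) := by
    have h1 : ⟪Q (B (Q (u : H))), (u : H)⟫ = ⟪B (Q (u : H)), Q (u : H)⟫ := hQsa.isSymmetric _ _
    have h2 : ⟪S (S (u : H)), (u : H)⟫ = ⟪S (u : H), S (u : H)⟫ := hSsa.isSymmetric _ _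
    rw [h1, hu, ← hSB, h2, inner_self_eq_norm_sq_to_K]
    norm_cast
  have hL : (⟪L u, (u : H)⟫).im = 0 := by
    have h := congrArg Complex.im (inner_conj_symm (𝕜 := ℂ) (u : H) (L u))
    rw [← hsym u u, Complex.conj_im] at h
    linarith
  have hu_im : (⟪(u : H), (u : H)⟫).im = 0 := inner_self_im (𝕜 := ℂ) (u : H)
  have him : (⟪F, (u : H)⟫).im = μ * ‖S (u : H)‖ ^ 2 := by
    rw [hF, inner_add_left, inner_sub_left, inner_neg_left, inner_smul_left, inner_smul_left, hQB,
      ← Complex.ofReal_pow, Complex.conj_ofReal, Complex.add_im, Complex.im_ofReal_mul, hu_im]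
    simp [hL, -Complex.ofReal_pow]
  have hdamp : ‖S (u : H)‖ ^ 2 ≤ ‖F‖ / |μ| * ‖(u : H)‖ := by
    have h := (Complex.abs_im_le_norm ⟪F, (u : H)⟫).trans (norm_inner_le_norm _ _)
    rw [him, abs_mul, abs_of_nonneg (sq_nonneg ‖S (u : H)‖)] at h
    rw [div_mul_eq_mul_div, le_div_iff₀ hm]
    linarith
  have hP : ‖-(L u) + ((μ : ℂ) ^ 2) • (u : H)‖ ≤ ‖F‖ + |μ| * (‖S‖ * ‖S (u : H)‖) := by
    have heq : -(L u) + ((μ : ℂ) ^ 2) • (u : H)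
        = F + (Complex.I * (μ : ℂ)) • Q (B (Q (u : H))) := by
      rw [hF]; abel
    have hQBu : ‖Q (B (Q (u : H)))‖ ≤ ‖S‖ * ‖S (u : H)‖ := by
      refine (norm_apply_le_of_isSelfAdjoint_of_idempotent hQsa hQproj _).trans ?_
      rw [hu, ← hSB]
      exact S.le_opNorm _
    rw [heq]
    refine (norm_add_le _ _).trans ?_
    rw [norm_smul, norm_mul, Complex.norm_I, one_mul, Complex.norm_real, Real.norm_eq_abs]
    gcongr
  have hmain : ‖(u : H)‖ ≤ f * (‖F‖ / |μ|) + (f * ‖S‖ + g) * ‖S (u : H)‖ := by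
    calc ‖(u : H)‖ ≤ f / |μ| * ‖-(L u) + ((μ : ℂ) ^ 2) • (u : H)‖ + g * ‖S (u : H)‖ := hobs u
      _ ≤ f / |μ| * (‖F‖ + |μ| * (‖S‖ * ‖S (u : H)‖)) + g * ‖S (u : H)‖ := by gcongr
      _ = f * (‖F‖ / |μ|) + (f * ‖S‖ + g) * ‖S (u : H)‖ := by field_simp; ring
  calc ‖(u : H)‖ ≤ _ := le_nine_mul_max_of_le_add (norm_nonneg _) (by positivity) hmain hdamp
    _ = _ := by ring
end

section
/- Let Q : H → H be an orthogonal projection and let μ ∈ ℝ with μ ≠ 0. Then for every u ∈ D(L) with Qu = u, one has ⟪Bu, u⟫ = ‖√B u‖² ≤ (1/|μ|)·‖P_{QBQ}(μ)u‖·‖u‖, where P_{QBQ}(μ)u = −Lu − iμ·QBQu + μ²u. (Estimate (demo-eq-1) in the proof of Proposition 'prop-1-appendix-high-frequencies'.) -/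
local notation "⟪" x ", " y "⟫" => @inner ℂ _ _ x y

/-- estimate (demo-eq-1) in the proof of Proposition
`prop-1-appendix-high-frequencies`.  For an orthogonal projection `Q` and `μ ≠ 0`,
every `u ∈ D(L)` with `Qu = u` satisfies
`⟪Bu, u⟫ = ‖√B u‖² ≤ (1/|μ|)·‖P_{QBQ}(μ)u‖·‖u‖`,
where `P_{QBQ}(μ)u = -Lu - iμ·QBQu + μ²u`. -/
theorem stmt_5
    {H : Type*} [NormedAddCommGroup H] [InnerProductSpace ℂ H] [CompleteSpace H]
    (D : Submodule ℂ H) (L : D →ₗ[ℂ] H)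
    (hsym : ∀ u v : D, ⟪L u, (v : H)⟫ = ⟪(u : H), L v⟫)
    (B S : H →L[ℂ] H) (hBsa : IsSelfAdjoint B)
    (hBpos : ∀ w : H, 0 ≤ (⟪B w, w⟫).re)
    (hSsa : IsSelfAdjoint S) (hSpos : ∀ w : H, 0 ≤ (⟪S w, w⟫).re)
    (hSB : ∀ w : H, S (S w) = B w)
    (Q : H →L[ℂ] H) (hQsa : IsSelfAdjoint Q) (hQproj : ∀ w : H, Q (Q w) = Q w)
    (μ : ℝ) (hμ : μ ≠ 0) :
    ∀ u : D, Q (u : H) = (u : H) →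
      ⟪B (u : H), (u : H)⟫ = ((‖S (u : H)‖ ^ 2 : ℝ) : ℂ) ∧
      ‖S (u : H)‖ ^ 2 ≤ 1 / |μ| *
        (‖-(L u) - (Complex.I * (μ : ℂ)) • Q (B (Q (u : H))) + ((μ : ℂ) ^ 2) • (u : H)‖ *
          ‖(u : H)‖) := by
  intro u hu
  have hS : ⟪B (u : H), (u : H)⟫ = ((‖S (u : H)‖ ^ 2 : ℝ) : ℂ) := by
    rw [← hSB, hSsa.isSymmetric.apply_clm, inner_self_eq_norm_sq_to_K]
    norm_cast
  refine ⟨hS, ?_⟩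
  have hQ : ⟪Q (B (Q (u : H))), (u : H)⟫ = ((‖S (u : H)‖ ^ 2 : ℝ) : ℂ) := by
    rw [hQsa.isSymmetric.apply_clm, hu, hS]
  have hL : (⟪L u, (u : H)⟫).im = 0 := by
    rw [← Complex.conj_eq_iff_im, inner_conj_symm, hsym]
  have him : (⟪-(L u) - (Complex.I * (μ : ℂ)) • Q (B (Q (u : H))) + ((μ : ℂ) ^ 2) • (u : H),
      (u : H)⟫).im = μ * ‖S (u : H)‖ ^ 2 := by
    have hμ_conj : (starRingEnd ℂ) ((μ : ℂ) ^ 2) = ((μ ^ 2 : ℝ) : ℂ) := by simp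
    have huu : ⟪(u : H), (u : H)⟫ = ((‖(u : H)‖ ^ 2 : ℝ) : ℂ) := by
      rw [inner_self_eq_norm_sq_to_K]
      norm_cast
    rw [inner_add_left, inner_sub_left, inner_neg_left, inner_smul_left, inner_smul_left, hQ, huu,
      hμ_conj, ← Complex.ofReal_mul, Complex.add_im, Complex.ofReal_im, Complex.sub_im,
      Complex.neg_im, hL, map_mul, Complex.conj_I, Complex.conj_ofReal, mul_assoc,
      ← Complex.ofReal_mul]
    simp [-Complex.ofReal_pow, -Complex.ofReal_mul]
  rw [one_div, ← div_eq_inv_mul, le_div_iff₀' (abs_pos.mpr hμ)]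
  calc |μ| * ‖S (u : H)‖ ^ 2 = |μ * ‖S (u : H)‖ ^ 2| := by rw [abs_mul, abs_sq]
    _ ≤ _ := by
      rw [← him]
      exact (Complex.abs_im_le_norm _).trans (norm_inner_le_norm _ _)
end

section
/- Let Q : H → H be an orthogonal projection and let μ ∈ ℝ with μ ≠ 0. Then for every u ∈ D(L) with Qu = u, one has ‖QBQu‖² ≤ (‖√B‖²/|μ|)·‖P_{QBQ}(μ)u‖·‖u‖, where P_{QBQ}(μ)u = −Lu − iμ·QBQu + μ²u and ‖√B‖ is the operator norm of √B. (Displayed estimate in the proof of Proposition 'prop-1-appendix-high-frequencies'.) -/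
local notation "⟪" x ", " y "⟫" => @inner ℂ _ _ x y

theorem IsSelfAdjoint.inner_map_left {H : Type*} [NormedAddCommGroup H] [InnerProductSpace ℂ H]
    [CompleteSpace H] {T : H →L[ℂ] H} (hT : IsSelfAdjoint T) (x y : H) :
    inner ℂ (T x) y = inner ℂ x (T y) :=
  hT.isSymmetric x y

theorem IsSelfAdjoint.norm_map_le_of_idempotent {H : Type*} [NormedAddCommGroup H]
    [InnerProductSpace ℂ H] [CompleteSpace H] {Q : H →L[ℂ] H} (hQ : IsSelfAdjoint Q)
    (hproj : ∀ w : H, Q (Q w) = Q w) (x : H) : ‖Q x‖ ≤ ‖x‖ := by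
  have h : ‖Q x‖ * ‖Q x‖ ≤ ‖x‖ * ‖Q x‖ := by
    rw [← inner_self_eq_norm_mul_norm (𝕜 := ℂ), hQ.inner_map_left, hproj]
    exact re_inner_le_norm x (Q x)
  rcases (norm_nonneg (Q x)).eq_or_lt with h0 | h0
  · exact h0 ▸ norm_nonneg x
  · exact le_of_mul_le_mul_right h h0

/-- displayed estimate in the proof of Proposition
`prop-1-appendix-high-frequencies`.  For an orthogonal projection `Q` and `μ ≠ 0`,
every `u ∈ D(L)` with `Qu = u` satisfies
`‖QBQu‖² ≤ (‖√B‖²/|μ|)·‖P_{QBQ}(μ)u‖·‖u‖`,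
where `P_{QBQ}(μ)u = -Lu - iμ·QBQu + μ²u`. -/
theorem stmt_6
    {H : Type*} [NormedAddCommGroup H] [InnerProductSpace ℂ H] [CompleteSpace H]
    (D : Submodule ℂ H) (L : D →ₗ[ℂ] H)
    (hsym : ∀ u v : D, ⟪L u, (v : H)⟫ = ⟪(u : H), L v⟫)
    (B S : H →L[ℂ] H) (hBsa : IsSelfAdjoint B)
    (hBpos : ∀ w : H, 0 ≤ (⟪B w, w⟫).re)
    (hSsa : IsSelfAdjoint S) (hSpos : ∀ w : H, 0 ≤ (⟪S w, w⟫).re)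
    (hSB : ∀ w : H, S (S w) = B w)
    (Q : H →L[ℂ] H) (hQsa : IsSelfAdjoint Q) (hQproj : ∀ w : H, Q (Q w) = Q w)
    (μ : ℝ) (hμ : μ ≠ 0) :
    ∀ u : D, Q (u : H) = (u : H) →
      ‖Q (B (Q (u : H)))‖ ^ 2 ≤ ‖S‖ ^ 2 / |μ| *
        (‖-(L u) - (Complex.I * (μ : ℂ)) • Q (B (Q (u : H))) + ((μ : ℂ) ^ 2) • (u : H)‖ *
          ‖(u : H)‖) := by
  intro u hu
  rw [hu]
  set p : H := -(L u) - (Complex.I * (μ : ℂ)) • Q (B (u : H)) + ((μ : ℂ) ^ 2) • (u : H) with hp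
  have hQB : ⟪Q (B (u : H)), (u : H)⟫ = ((‖S (u : H)‖ ^ 2 : ℝ) : ℂ) := by
    rw [hQsa.inner_map_left, hu, ← hSB, hSsa.inner_map_left, inner_self_eq_norm_sq_to_K]
    norm_cast
  have hL : (⟪L u, (u : H)⟫).im = 0 := by
    rw [← Complex.conj_eq_iff_im, inner_conj_symm, hsym]
  have him : (⟪p, (u : H)⟫).im = μ * ‖S (u : H)‖ ^ 2 := by
    rw [hp, inner_add_left, inner_sub_left, inner_neg_left, inner_smul_left, inner_smul_left, hQB,
      inner_self_eq_norm_sq_to_K]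
    simp [hL, ← Complex.ofReal_pow]
  have hS : |μ| * ‖S (u : H)‖ ^ 2 ≤ ‖p‖ * ‖(u : H)‖ := by
    have h := (Complex.abs_im_le_norm ⟪p, (u : H)⟫).trans (norm_inner_le_norm p (u : H))
    rwa [him, abs_mul, abs_of_nonneg (sq_nonneg ‖S (u : H)‖)] at h
  have hQBu : ‖Q (B (u : H))‖ ≤ ‖S‖ * ‖S (u : H)‖ := by
    refine (hQsa.norm_map_le_of_idempotent hQproj _).trans ?_
    rw [← hSB]
    exact S.le_opNorm _
  have hμ' : 0 < |μ| := abs_pos.mpr hμ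
  calc ‖Q (B (u : H))‖ ^ 2 ≤ (‖S‖ * ‖S (u : H)‖) ^ 2 := by gcongr
    _ = ‖S‖ ^ 2 / |μ| * (|μ| * ‖S (u : H)‖ ^ 2) := by field_simp
    _ ≤ ‖S‖ ^ 2 / |μ| * (‖p‖ * ‖(u : H)‖) := by gcongr
end

section
/- Let Q : H → H be an orthogonal projection, μ ∈ ℝ with μ ≠ 0, and M > 0. Assume that for every v ∈ D(L) with Qv = v one has ‖v‖ ≤ (M/|μ|)·‖P_{QBQ}(μ)v‖, where P_{QBQ}(μ)v = −Lv − iμ·QBQv + μ²v. Then for every u ∈ D(L) with Qu = u, the (real) number ⟪Lu, u⟫ satisfies ⟪Lu, u⟫ ≤ (M² + M/|μ|)·‖P_{QBQ}(μ)u‖². (Intermediate estimate in the proof of Proposition 'prop-2-appendix'.) -/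
local notation "⟪" x ", " y "⟫" => @inner ℂ _ _ x y

/-- intermediate estimate in the proof of Proposition `prop-2-appendix`.
Let `Q` be an orthogonal projection, `μ ≠ 0`, `M > 0`.  If every `v ∈ D(L)` with `Qv = v`
satisfies `‖v‖ ≤ (M/|μ|)·‖P_{QBQ}(μ)v‖`, then every `u ∈ D(L)` with `Qu = u` satisfies
`⟪Lu, u⟫ ≤ (M² + M/|μ|)·‖P_{QBQ}(μ)u‖²`, where `P_{QBQ}(μ)u = -Lu - iμ·QBQu + μ²u`
(and `⟪Lu, u⟫` is real since `L` is symmetric). -/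
theorem stmt_8
    {H : Type*} [NormedAddCommGroup H] [InnerProductSpace ℂ H] [CompleteSpace H]
    (D : Submodule ℂ H) (L : D →ₗ[ℂ] H)
    (hsym : ∀ u v : D, ⟪L u, (v : H)⟫ = ⟪(u : H), L v⟫)
    (B : H →L[ℂ] H) (hBsa : IsSelfAdjoint B)
    (hBpos : ∀ w : H, 0 ≤ (⟪B w, w⟫).re)
    (Q : H →L[ℂ] H) (hQsa : IsSelfAdjoint Q) (hQproj : ∀ w : H, Q (Q w) = Q w)
    (μ : ℝ) (hμ : μ ≠ 0) (M : ℝ) (hM : 0 < M)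
    (hyp : ∀ v : D, Q (v : H) = (v : H) →
      ‖(v : H)‖ ≤ M / |μ| *
        ‖-(L v) - (Complex.I * (μ : ℂ)) • Q (B (Q (v : H))) + ((μ : ℂ) ^ 2) • (v : H)‖) :
    ∀ u : D, Q (u : H) = (u : H) →
      (⟪L u, (u : H)⟫).re ≤ (M ^ 2 + M / |μ|) *
        ‖-(L u) - (Complex.I * (μ : ℂ)) • Q (B (Q (u : H))) + ((μ : ℂ) ^ 2) • (u : H)‖ ^ 2 := by
  intro u hu
  have him : (⟪Q (B (Q (u : H))), (u : H)⟫).im = 0 := by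
    have hself : ⟪Q (B (Q (u : H))), (u : H)⟫ = ⟪(u : H), Q (B (Q (u : H)))⟫ := by
      have hQ := hQsa.isSymmetric
      have hB := hBsa.isSymmetric
      exact (hQ _ _).trans ((hB _ _).trans (hQ _ _))
    exact Complex.conj_eq_iff_im.mp ((inner_conj_symm _ _).trans hself.symm)
  set p : H := -(L u) - (Complex.I * (μ : ℂ)) • Q (B (Q (u : H))) + ((μ : ℂ) ^ 2) • (u : H)
    with hp
  have hnorm : ‖(u : H)‖ ≤ M / |μ| * ‖p‖ := hyp u hu
  have hre : (⟪p, (u : H)⟫).re = -(⟪L u, (u : H)⟫).re + μ ^ 2 * ‖(u : H)‖ ^ 2 := by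
    have hsq : ⟪(u : H), (u : H)⟫ = ((‖(u : H)‖ ^ 2 : ℝ) : ℂ) := by
      rw [inner_self_eq_norm_sq_to_K]
      norm_cast
    have hμsq : ((μ : ℂ) ^ 2) = ((μ ^ 2 : ℝ) : ℂ) := by norm_cast
    rw [hp, inner_add_left, inner_sub_left, inner_neg_left, inner_smul_left, inner_smul_left,
      hsq, hμsq, Complex.conj_ofReal, ← Complex.ofReal_mul, Complex.add_re, Complex.ofReal_re]
    simp [him]
  have hcs : -(⟪p, (u : H)⟫).re ≤ ‖p‖ * ‖(u : H)‖ :=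
    (neg_le_abs _).trans ((Complex.abs_re_le_norm _).trans (norm_inner_le_norm _ _))
  have hμpos : 0 < |μ| := abs_pos.mpr hμ
  have hscaled : |μ| * ‖(u : H)‖ ≤ M * ‖p‖ := by
    calc |μ| * ‖(u : H)‖ ≤ |μ| * (M / |μ| * ‖p‖) := by gcongr
      _ = M * ‖p‖ := by field_simp
  have hsquare : μ ^ 2 * ‖(u : H)‖ ^ 2 ≤ M ^ 2 * ‖p‖ ^ 2 := by
    rw [← sq_abs μ, ← mul_pow, ← mul_pow]
    gcongr
  have hprod : ‖p‖ * ‖(u : H)‖ ≤ ‖p‖ * (M / |μ| * ‖p‖) := by gcongr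
  linarith
end

section
/- Let α > 1 and σ ∈ (0, 1]. Then sup over t ≥ 0 of the integral ∫₀ᵗ ((1+t)/(1+s))^{σα} · (1 + (t−s))^{−α} ds is finite; that is, there exists C > 0 such that for all t ≥ 0, ∫₀ᵗ ((1+t)/(1+s))^{σα} (1+(t−s))^{−α} ds ≤ C. (The uniform bound on I(t) in the proof of the polynomial case of Proposition 1.) -/
open Real

/-- If `z ≤ x + y`, then `z ≤ 2 max x y`, so `z ^ α` is absorbed by the smaller negative power. -/
lemma rpow_mul_rpow_neg_le {α x y z : ℝ} (hα : 0 ≤ α) (hx : 0 < x) (hy : 0 < y) (hz : 0 ≤ z)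
    (h : z ≤ x + y) :
    z ^ α * x ^ (-α) * y ^ (-α) ≤ 2 ^ α * (x ^ (-α) + y ^ (-α)) := by
  have key : ∀ {a b : ℝ}, 0 < a → 0 < b → a ≤ b → z ≤ a + b →
      z ^ α * a ^ (-α) * b ^ (-α) ≤ 2 ^ α * a ^ (-α) := by
    intro a b ha hb hab hzab
    have h1 : z ^ α ≤ 2 ^ α * b ^ α := by
      rw [← mul_rpow zero_le_two hb.le]
      exact rpow_le_rpow hz (by linarith) hα
    have h2 : b ^ α * b ^ (-α) = 1 := by rw [← rpow_add hb, add_neg_cancel, rpow_zero]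
    calc z ^ α * a ^ (-α) * b ^ (-α) ≤ 2 ^ α * b ^ α * a ^ (-α) * b ^ (-α) := by gcongr
      _ = 2 ^ α * a ^ (-α) * (b ^ α * b ^ (-α)) := by ring
      _ = 2 ^ α * a ^ (-α) := by rw [h2, mul_one]
  have hx' : 0 ≤ (2 : ℝ) ^ α * x ^ (-α) := by positivity
  have hy' : 0 ≤ (2 : ℝ) ^ α * y ^ (-α) := by positivity
  rcases le_total x y with hxy | hxy
  · linarith [key hx hy hxy h]
  · linarith [key hy hx hxy (by linarith), mul_right_comm (z ^ α) (x ^ (-α)) (y ^ (-α))]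

lemma integral_one_add_rpow_neg_le {α t : ℝ} (hα : 1 < α) (ht : 0 ≤ t) :
    (∫ s in (0:ℝ)..t, (1 + s) ^ (-α)) ≤ 1 / (α - 1) := by
  rw [intervalIntegral.integral_comp_add_left (fun s : ℝ => s ^ (-α)) 1, add_zero,
    integral_rpow (Or.inr ⟨by linarith, by
      rw [Set.uIcc_of_le (by linarith)]
      exact fun h => by linarith [h.1]⟩), one_rpow]
  have h1 : 0 ≤ (1 + t) ^ (-α + 1) := by positivity
  have h2 : 0 < α - 1 := by linarith
  rw [← neg_div_neg_eq, show -(-α + 1) = α - 1 by ring]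
  gcongr
  linarith

/-- uniform bound on `I(t)` in the proof of the polynomial case of
Proposition 1.  For `α > 1` and `σ ∈ (0,1]` the integrals
`∫₀ᵗ ((1+t)/(1+s))^{σα} (1+(t−s))^{−α} ds` are bounded uniformly in `t ≥ 0`. -/
theorem stmt_10 (α σ : ℝ) (hα : 1 < α) (hσ : 0 < σ) (hσ1 : σ ≤ 1) :
    ∃ C : ℝ, 0 < C ∧ ∀ t : ℝ, 0 ≤ t →
      (∫ s in (0:ℝ)..t, ((1 + t) / (1 + s)) ^ (σ * α) * (1 + (t - s)) ^ (-α)) ≤ C := by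
  have hα1 : 0 < α - 1 := by linarith
  refine ⟨2 ^ α * (1 / (α - 1) + 1 / (α - 1)), by positivity, fun t ht => ?_⟩
  have hpos : ∀ s ∈ Set.uIcc 0 t, 0 < 1 + s ∧ 0 < 1 + (t - s) := by
    intro s hs
    rw [Set.uIcc_of_le ht] at hs
    exact ⟨by linarith [hs.1], by linarith [hs.2]⟩
  have c1 : ContinuousOn (fun s : ℝ => (1 + s) ^ (-α)) (Set.uIcc 0 t) :=
    ContinuousOn.rpow_const (by fun_prop) fun s hs => Or.inl (hpos s hs).1.ne'
  have c2 : ContinuousOn (fun s : ℝ => (1 + (t - s)) ^ (-α)) (Set.uIcc 0 t) :=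
    ContinuousOn.rpow_const (by fun_prop) fun s hs => Or.inl (hpos s hs).2.ne'
  have c3 : ContinuousOn (fun s : ℝ => ((1 + t) / (1 + s)) ^ (σ * α)) (Set.uIcc 0 t) :=
    ContinuousOn.rpow_const
      (ContinuousOn.div (by fun_prop) (by fun_prop) fun s hs => (hpos s hs).1.ne')
      fun s _ => Or.inr (by positivity)
  calc (∫ s in (0:ℝ)..t, ((1 + t) / (1 + s)) ^ (σ * α) * (1 + (t - s)) ^ (-α))
      ≤ ∫ s in (0:ℝ)..t, 2 ^ α * ((1 + s) ^ (-α) + (1 + (t - s)) ^ (-α)) := by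
        refine intervalIntegral.integral_mono_on ht (c3.mul c2).intervalIntegrable
          (continuousOn_const.mul (c1.add c2)).intervalIntegrable fun s hs => ?_
        obtain ⟨hx, hy⟩ := hpos s (Set.Icc_subset_uIcc hs)
        have hle : ((1 + t) / (1 + s)) ^ (σ * α) ≤ (1 + t) ^ α * (1 + s) ^ (-α) := by
          rw [rpow_neg hx.le, ← div_eq_mul_inv, ← div_rpow (by linarith) hx.le]
          refine rpow_le_rpow_of_exponent_le ?_ (by nlinarith)
          rw [le_div_iff₀ hx]
          linarith [hs.2]
        exact (mul_le_mul_of_nonneg_right hle (by positivity)).trans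
          (rpow_mul_rpow_neg_le (by linarith) hx hy (by linarith) (by linarith))
    _ = 2 ^ α * ((∫ s in (0:ℝ)..t, (1 + s) ^ (-α)) + ∫ s in (0:ℝ)..t, (1 + s) ^ (-α)) := by
        rw [intervalIntegral.integral_const_mul,
          intervalIntegral.integral_add c1.intervalIntegrable c2.intervalIntegrable,
          intervalIntegral.integral_comp_sub_left (fun s : ℝ => (1 + s) ^ (-α)) t,
          sub_self, sub_zero]
    _ ≤ 2 ^ α * (1 / (α - 1) + 1 / (α - 1)) := by
        gcongr <;> exact integral_one_add_rpow_neg_le hα ht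
end

section
/- Let α > 1 and σ ∈ (0, 1]. There exists C > 0 such that for all t ≥ 1, ∫_{1/(t+2)}^{1−1/(t+2)} τ^{−σα} (1−τ)^{−α} dτ ≤ C · t^{α−1}. (The asymptotic estimate of the truncated Beta-type integral in the proof of the polynomial case of Proposition 1.) -/
open Real

/-- Since one of `τ`, `1 - τ` is at least `1 / 2`, the Beta-type integrand is controlled by the sum
of its two one-sided singularities. -/
theorem rpow_neg_mul_one_sub_rpow_neg_le {α β τ : ℝ} (hα : 0 ≤ α) (hβ : β ≤ α)
    (h0 : 0 < τ) (h1 : τ < 1) :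
    τ ^ (-β) * (1 - τ) ^ (-α) ≤ 2 ^ α * (τ ^ (-α) + (1 - τ) ^ (-α)) := by
  have half : ∀ x : ℝ, 1 / 2 ≤ x → x ^ (-α) ≤ 2 ^ α := fun x hx => by
    calc x ^ (-α) ≤ (1 / 2 : ℝ) ^ (-α) :=
          rpow_le_rpow_of_nonpos (by norm_num) hx (by linarith)
      _ = 2 ^ α := by rw [one_div, inv_rpow zero_le_two, rpow_neg zero_le_two, inv_inv]
  have hx : 0 < τ ^ (-α) := rpow_pos_of_pos h0 _
  have hy : 0 < (1 - τ) ^ (-α) := rpow_pos_of_pos (by linarith) _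
  have h2 : (0 : ℝ) < 2 ^ α := by positivity
  have hβα : τ ^ (-β) ≤ τ ^ (-α) :=
    rpow_le_rpow_of_exponent_ge h0 h1.le (by linarith)
  refine (mul_le_mul_of_nonneg_right hβα hy.le).trans ?_
  rcases le_total (1 / 2) τ with h | h
  · nlinarith [mul_le_mul_of_nonneg_right (half τ h) hy.le, mul_pos h2 hx]
  · nlinarith [mul_le_mul_of_nonneg_left (half (1 - τ) (by linarith)) hx.le, mul_pos h2 hy]

theorem integral_rpow_neg_le {α a b : ℝ} (hα : 1 < α) (ha : 0 < a) (hab : a ≤ b) :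
    ∫ x in a..b, x ^ (-α) ≤ a ^ (1 - α) / (α - 1) := by
  have h0 : (0 : ℝ) ∉ Set.uIcc a b := by
    rw [Set.uIcc_of_le hab]
    exact fun h => ha.not_ge h.1
  rw [integral_rpow (Or.inr ⟨by linarith, h0⟩), show -α + 1 = -(α - 1) by ring, div_neg, ← neg_div,
    show 1 - α = -(α - 1) by ring]
  have hb : 0 ≤ b ^ (-(α - 1)) := rpow_nonneg (ha.le.trans hab) _
  have hα' : 0 < α - 1 := by linarith
  gcongr
  linarith

/-- asymptotic estimate of the truncated Beta-type integral in the proof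
of the polynomial case of Proposition 1.  For `α > 1` and `σ ∈ (0,1]` there is `C > 0`
such that for all `t ≥ 1`,
`∫_{1/(t+2)}^{1−1/(t+2)} τ^{−σα} (1−τ)^{−α} dτ ≤ C·t^{α−1}`. -/
theorem stmt_11 (α σ : ℝ) (hα : 1 < α) (hσ : 0 < σ) (hσ1 : σ ≤ 1) :
    ∃ C : ℝ, 0 < C ∧ ∀ t : ℝ, 1 ≤ t →
      (∫ τ in (1 / (t + 2))..(1 - 1 / (t + 2)), τ ^ (-(σ * α)) * (1 - τ) ^ (-α))
        ≤ C * t ^ (α - 1) := by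
  have hα' : 0 < α - 1 := by linarith
  refine ⟨2 ^ α * (2 * (3 ^ (α - 1) / (α - 1))), by positivity, fun t ht => ?_⟩
  set ε : ℝ := 1 / (t + 2) with hε
  have hε0 : 0 < ε := by positivity
  have hε3 : ε ≤ 1 / 3 := one_div_le_one_div_of_le (by norm_num) (by linarith)
  have hle : ε ≤ 1 - ε := by linarith
  have bounds : ∀ x ∈ Set.uIcc ε (1 - ε), 0 < x ∧ 0 < 1 - x := fun x hx => by
    rw [Set.uIcc_of_le hle] at hx
    exact ⟨hε0.trans_le hx.1, by linarith [hx.2]⟩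
  have cont : ∀ r : ℝ, ContinuousOn (fun x : ℝ => x ^ r) (Set.uIcc ε (1 - ε)) := fun r =>
    continuousOn_id.rpow_const fun x hx => Or.inl (bounds x hx).1.ne'
  have cont' : ∀ r : ℝ, ContinuousOn (fun x : ℝ => (1 - x) ^ r) (Set.uIcc ε (1 - ε)) := fun r =>
    (continuousOn_const.sub continuousOn_id).rpow_const fun x hx => Or.inl (bounds x hx).2.ne'
  have symm_eq : ∫ x in ε..(1 - ε), (1 - x) ^ (-α) = ∫ x in ε..(1 - ε), x ^ (-α) := by
    rw [intervalIntegral.integral_comp_sub_left (fun x : ℝ => x ^ (-α)) 1, sub_sub_cancel]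
  have hεpow : ε ^ (1 - α) ≤ 3 ^ (α - 1) * t ^ (α - 1) := by
    rw [hε, one_div, inv_rpow (by linarith), ← rpow_neg (by linarith), neg_sub,
      ← mul_rpow (by norm_num) (by linarith)]
    exact rpow_le_rpow (by linarith) (by linarith) hα'.le
  calc ∫ τ in ε..(1 - ε), τ ^ (-(σ * α)) * (1 - τ) ^ (-α)
      ≤ ∫ τ in ε..(1 - ε), 2 ^ α * (τ ^ (-α) + (1 - τ) ^ (-α)) := by
        refine intervalIntegral.integral_mono_on hle ((cont _).mul (cont' _)).intervalIntegrable
          (((cont _).add (cont' _)).const_mul _).intervalIntegrable fun x hx => ?_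
        exact rpow_neg_mul_one_sub_rpow_neg_le (by linarith) (by nlinarith)
          (hε0.trans_le hx.1) (by linarith [hx.2])
    _ = 2 ^ α * (2 * ∫ x in ε..(1 - ε), x ^ (-α)) := by
        rw [intervalIntegral.integral_const_mul, intervalIntegral.integral_add
          (cont _).intervalIntegrable (cont' _).intervalIntegrable, symm_eq, two_mul]
    _ ≤ 2 ^ α * (2 * (3 ^ (α - 1) * t ^ (α - 1) / (α - 1))) := by
        have := integral_rpow_neg_le hα hε0 hle
        gcongr
        exact this.trans (by gcongr)
    _ = 2 ^ α * (2 * (3 ^ (α - 1) / (α - 1))) * t ^ (α - 1) := by ring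
end

section
/- Let c > 0, γ ∈ (0, 1) and σ ∈ (0, 1]. Then sup over t ≥ 0 of the integral ∫₀ᵗ exp(σc(t^γ − s^γ)) · exp(−c(t−s)^γ) ds is finite; that is, there exists C > 0 such that for all t ≥ 0, ∫₀ᵗ exp(σc(t^γ − s^γ) − c(t−s)^γ) ds ≤ C. (The uniform bound on I(t) in the proof of the exponential case of Proposition 1.) -/
open Real

/-- A quantitative form of the subadditivity of `x ↦ x ^ γ` for an exponent `γ ∈ [0,1]`. -/
lemma two_sub_two_rpow_mul_rpow_le {γ u v : ℝ} (hγ : 0 ≤ γ) (hγ1 : γ ≤ 1) (hu : 0 ≤ u)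
    (huv : u ≤ v) : (2 - 2 ^ γ) * u ^ γ ≤ u ^ γ + v ^ γ - (u + v) ^ γ := by
  rcases hu.eq_or_lt with rfl | hu'
  · rcases hγ.eq_or_lt with rfl | hγ'
    · norm_num
    · simp [zero_rpow hγ'.ne']
  have hv : 0 < v := hu'.trans_le huv
  have hconc := Real.concaveOn_rpow hγ hγ1
  have ha : 0 ≤ u / v := by positivity
  have hb : 0 ≤ 1 - u / v := sub_nonneg.2 ((div_le_one hv).2 huv)
  have hu0 : u ∈ Set.Ici (0 : ℝ) := hu
  have huv0 : u + v ∈ Set.Ici (0 : ℝ) := (add_pos hu' hv).le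
  have h1 := hconc.2 hu0 huv0 ha hb (by ring)
  have h2 := hconc.2 hu0 huv0 hb ha (by ring)
  have e1 : u / v * u + (1 - u / v) * (u + v) = v := by field_simp; ring
  have e2 : (1 - u / v) * u + u / v * (u + v) = 2 * u := by field_simp; ring
  simp only [smul_eq_mul, e1] at h1
  simp only [smul_eq_mul, e2, mul_rpow zero_le_two hu] at h2
  linarith

lemma integrableOn_exp_neg_mul_rpow {p b : ℝ} (hp : 0 < p) (hb : 0 < b) :
    MeasureTheory.IntegrableOn (fun x : ℝ => exp (-b * x ^ p)) (Set.Ioi 0) := by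
  simpa using integrableOn_rpow_mul_exp_neg_mul_rpow (s := 0) (by norm_num) hp hb

lemma intervalIntegral_exp_neg_mul_rpow_le {p b t : ℝ} (hp : 0 < p) (hb : 0 < b) (ht : 0 ≤ t) :
    ∫ s in (0 : ℝ)..t, exp (-b * s ^ p) ≤ ∫ s in Set.Ioi (0 : ℝ), exp (-b * s ^ p) := by
  rw [intervalIntegral.integral_of_le ht]
  exact MeasureTheory.setIntegral_mono_set (integrableOn_exp_neg_mul_rpow hp hb)
    (.of_forall fun _ => (exp_pos _).le) (Set.Ioc_subset_Ioi_self).eventuallyLE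

lemma exp_rpow_sub_le_add {c γ σ s t : ℝ} (hc : 0 ≤ c) (hγ : 0 ≤ γ) (hγ1 : γ ≤ 1)
    (hσ1 : σ ≤ 1) (hs : 0 ≤ s) (hst : s ≤ t) :
    exp (σ * c * (t ^ γ - s ^ γ) - c * (t - s) ^ γ) ≤
      exp (-(c * (2 - 2 ^ γ)) * s ^ γ) + exp (-(c * (2 - 2 ^ γ)) * (t - s) ^ γ) := by
  have hmono : 0 ≤ t ^ γ - s ^ γ := sub_nonneg.2 (rpow_le_rpow hs hst hγ)
  have hσc : σ * (c * (t ^ γ - s ^ γ)) ≤ c * (t ^ γ - s ^ γ) :=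
    mul_le_of_le_one_left (mul_nonneg hc hmono) hσ1
  rcases le_total s (t - s) with h | h
  · have key := mul_le_mul_of_nonneg_left (two_sub_two_rpow_mul_rpow_le hγ hγ1 hs h) hc
    rw [add_sub_cancel] at key
    refine (exp_le_exp.2 ?_).trans (le_add_of_nonneg_right (exp_pos _).le)
    linarith
  · have key := mul_le_mul_of_nonneg_left
      (two_sub_two_rpow_mul_rpow_le hγ hγ1 (sub_nonneg.2 hst) h) hc
    rw [sub_add_cancel] at key
    refine (exp_le_exp.2 ?_).trans (le_add_of_nonneg_left (exp_pos _).le)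
    linarith

/-- uniform bound on `I(t)` in the proof of the exponential case of
Proposition 1.  For `c > 0`, `γ ∈ (0,1)` and `σ ∈ (0,1]`, the integrals
`∫₀ᵗ exp(σc(t^γ − s^γ) − c(t−s)^γ) ds` are bounded uniformly in `t ≥ 0`. -/
theorem stmt_12 (c γ σ : ℝ) (hc : 0 < c) (hγ : 0 < γ) (hγ1 : γ < 1)
    (hσ : 0 < σ) (hσ1 : σ ≤ 1) :
    ∃ C : ℝ, 0 < C ∧ ∀ t : ℝ, 0 ≤ t →
      (∫ s in (0:ℝ)..t, Real.exp (σ * c * (t ^ γ - s ^ γ) - c * (t - s) ^ γ)) ≤ C := by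
  have h2 : (2 : ℝ) ^ γ < 2 := by
    simpa using rpow_lt_rpow_of_exponent_lt one_lt_two hγ1
  set k : ℝ := c * (2 - 2 ^ γ)
  have hk0 : 0 < k := mul_pos hc (sub_pos.2 h2)
  set M : ℝ := ∫ s in Set.Ioi (0 : ℝ), exp (-k * s ^ γ)
  have hM : 0 ≤ M := MeasureTheory.integral_nonneg fun _ => (exp_pos _).le
  refine ⟨2 * M + 1, by linarith, fun t ht => ?_⟩
  have hpow : Continuous fun s : ℝ => s ^ γ := continuous_id.rpow_const fun _ => Or.inr hγ.le
  have hpow' : Continuous fun s : ℝ => (t - s) ^ γ := hpow.comp (by fun_prop)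
  have hf : Continuous fun s : ℝ => exp (-k * s ^ γ) := by fun_prop
  have hg : Continuous fun s : ℝ => exp (-k * (t - s) ^ γ) := by fun_prop
  have hI : Continuous fun s : ℝ => exp (σ * c * (t ^ γ - s ^ γ) - c * (t - s) ^ γ) := by fun_prop
  have hM_le := intervalIntegral_exp_neg_mul_rpow_le hγ hk0 ht
  calc _ ≤ ∫ s in (0 : ℝ)..t, (exp (-k * s ^ γ) + exp (-k * (t - s) ^ γ)) :=
        intervalIntegral.integral_mono_on ht (hI.intervalIntegrable _ _)
          ((hf.add hg).intervalIntegrable _ _) fun s hs =>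
            exp_rpow_sub_le_add hc.le hγ.le hγ1.le hσ1 hs.1 hs.2
    _ = 2 * ∫ s in (0 : ℝ)..t, exp (-k * s ^ γ) := by
        rw [intervalIntegral.integral_add (hf.intervalIntegrable _ _) (hg.intervalIntegrable _ _),
          intervalIntegral.integral_comp_sub_left (fun s => exp (-k * s ^ γ)), sub_self, sub_zero,
          two_mul]
    _ ≤ 2 * M + 1 := by linarith
end

section
/- Let γ ∈ (0, 1). Then there exists ν > 0 such that for all τ ∈ [0, 1/2], 1 − τ^γ − (1−τ)^γ ≤ −ν · τ^γ. (Key pointwise inequality in the proof of the exponential case of Proposition 1.) -/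
open Real

/-- key pointwise inequality in the proof of the exponential case of
Proposition 1.  For `γ ∈ (0,1)` there exists `ν > 0` such that
`1 − τ^γ − (1−τ)^γ ≤ −ν·τ^γ` for all `τ ∈ [0, 1/2]`. -/
theorem stmt_13 (γ : ℝ) (hγ : 0 < γ) (hγ1 : γ < 1) :
    ∃ ν : ℝ, 0 < ν ∧ ∀ τ : ℝ, 0 ≤ τ → τ ≤ 1 / 2 →
      1 - τ ^ γ - (1 - τ) ^ γ ≤ -ν * τ ^ γ := by
  refine ⟨1 - (1 / 2 : ℝ) ^ (1 - γ), ?_, fun τ h0 h1 => ?_⟩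
  · exact sub_pos.mpr (rpow_lt_one (by norm_num) (by norm_num) (by linarith))
  have hbase : 1 - τ ≤ (1 - τ) ^ γ := by
    simpa using rpow_le_rpow_of_exponent_ge (by linarith) (by linarith : 1 - τ ≤ 1) hγ1.le
  have hsplit : τ = τ ^ γ * τ ^ (1 - γ) := by
    rw [← rpow_add' h0 (by norm_num), add_sub_cancel, rpow_one]
  have hτ : τ ≤ τ ^ γ * (1 / 2 : ℝ) ^ (1 - γ) :=
    hsplit.trans_le (mul_le_mul_of_nonneg_left
      (rpow_le_rpow h0 h1 (by linarith)) (rpow_nonneg h0 γ))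
  linarith
end
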